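/- arXiv:math/0604224 — 2 statements merged into one kernel-verified Lean document; each statement's English description precedes it below -/
import Mathlib

section
/- Let π : H → G be a surjective homomorphism of finite groups. Then the restriction map Res_π : R(G) → R(H), f ↦ f ∘ π, is an injective ring homomorphism whose image is a direct summand of the ℤ-module R(H); consequently the induced k-algebra homomorphism Res̄_π : kR(G) → kR(H) is injective, and ℓ_p(G) ≤ ℓ_p(H). -/
open scoped TensorProduct Classical

/-! Common definitions: the character ring of a finite group, following Bonnafé,
"On the character ring of a finite group". -/

/-- The set of characters of finite-dimensional `K`-linear representations of `G`. -/
def charSet (K G : Type u) [Field K] [Group G] : Set (G → K) :=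
  {f | ∃ V : FDRep K G, f = FDRep.character V}

/-- The character ring `R(G)` of virtual characters, i.e. the subring of the `K`-algebra of
functions `G → K` generated by the characters.  Over a splitting field of characteristic zero
this is exactly the set of `ℤ`-linear combinations of irreducible characters. -/
def charRing (K G : Type u) [Field K] [Group G] : Subring (G → K) :=
  Subring.closure (charSet K G)

/-- `g` is `p`-regular if its order is prime to `p`. -/
def IsPRegular (p : ℕ) {G : Type*} [Monoid G] (g : G) : Prop :=
  Nat.Coprime (orderOf g) p

/-- `g` is a `p`-element if its order is a power of `p`. -/
def IsPElement (p : ℕ) {G : Type*} [Monoid G] (g : G) : Prop :=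
  ∃ n : ℕ, orderOf g = p ^ n

/-- The `p'`-part `g_{p'}` of an element `g` of a finite group:  writing `orderOf g = q * m'`
with `q` the `p`-part of the order, this is `g ^ (q * u)` where `u` is the inverse of
`q` modulo `m'`; it is the unique `p`-regular power of `g` such that `g * g_{p'}⁻¹` is a
`p`-element commuting with it. -/
noncomputable def pPrimePart (p : ℕ) {G : Type*} [Group G] (g : G) : G :=
  g ^ (p ^ (orderOf g).factorization p *
      (((p : ZMod (orderOf g / p ^ (orderOf g).factorization p)) ^
        (orderOf g).factorization p)⁻¹).val)

/-- The `p'`-section `S_{p'}(C)` of the conjugacy class `C` of `g` : the set of all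
`x ∈ G` whose `p'`-part lies in the class of `g`. -/
def pSection (p : ℕ) {G : Type*} [Group G] (g : G) : Set G :=
  {x | IsConj g (pPrimePart p x)}

/-- The idempotent class function `e_C` attached to the class `C` of `g`:  the characteristic
function (with values in `K`) of the `p'`-section of `C`. -/
noncomputable def eFun (p : ℕ) (K : Type*) [Field K] {G : Type*} [Group G] (g : G) : G → K :=
  fun x => if IsConj g (pPrimePart p x) then 1 else 0

/-- The number of conjugacy classes of `G` contained in a subset `S`. -/
noncomputable def numClassesIn {G : Type*} [Group G] (S : Set G) : ℕ :=
  Nat.card {c : ConjClasses G // c.carrier ⊆ S}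

/-- The image of the localization `𝒪_𝔭` in the fraction field `K`: fractions `a / b` with
`b ∉ 𝔭`. -/
def locSet (𝒪 K : Type*) [CommRing 𝒪] [Field K] [Algebra 𝒪 K] (𝔭 : Ideal 𝒪) : Set K :=
  {x | ∃ a b : 𝒪, b ∉ 𝔭 ∧ x * algebraMap 𝒪 K b = algebraMap 𝒪 K a}

/-- `𝒪_𝔭 R(G)`: the `𝒪_𝔭`-span of the character ring inside class functions `G → K`,
realized as the subring generated by `𝒪_𝔭`-constants and characters. -/
def locCharRing (𝒪 : Type*) (K : Type u) [CommRing 𝒪] [Field K] [Algebra 𝒪 K] (𝔭 : Ideal 𝒪)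
    (G : Type u) [Group G] : Subring (G → K) :=
  Subring.closure ({f | ∃ x ∈ locSet 𝒪 K 𝔭, f = Function.const G x} ∪ charSet K G)

/-- The ideal `𝔭 · 𝒪_𝔭R(G)` of `𝒪_𝔭R(G)`, generated by the constants from `𝔭`. -/
def pConstIdeal (𝒪 : Type*) (K : Type u) [CommRing 𝒪] [Field K] [Algebra 𝒪 K] (𝔭 : Ideal 𝒪)
    (G : Type u) [Group G] : Ideal (locCharRing 𝒪 K 𝔭 G) :=
  Ideal.span {f | ∃ a ∈ 𝔭, (f : G → K) = Function.const G (algebraMap 𝒪 K a)}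

/-- `kR(G) = k ⊗_ℤ R(G)`, realized through the canonical identification
`k ⊗_ℤ R(G) ≅ 𝒪_𝔭R(G) ⧸ 𝔭·𝒪_𝔭R(G)` (where `k = 𝒪/𝔭`). -/
abbrev kCharRing (𝒪 : Type*) (K : Type u) [CommRing 𝒪] [Field K] [Algebra 𝒪 K] (𝔭 : Ideal 𝒪)
    (G : Type u) [Group G] :=
  locCharRing 𝒪 K 𝔭 G ⧸ pConstIdeal 𝒪 K 𝔭 G

/-- The ideal of `𝒪_𝔭R(G)` cutting out the block `R_𝔭(G, C)` with identity element the
idempotent `e : 𝒪_𝔭R(G)`, reduced mod `𝔭`:  the block `kR(G)·ē` is canonically the quotient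
by `𝔭·𝒪_𝔭R(G) + (1 - e)·𝒪_𝔭R(G)`. -/
def blockIdeal (𝒪 : Type*) (K : Type u) [CommRing 𝒪] [Field K] [Algebra 𝒪 K] (𝔭 : Ideal 𝒪)
    (G : Type u) [Group G] (e : locCharRing 𝒪 K 𝔭 G) : Ideal (locCharRing 𝒪 K 𝔭 G) :=
  pConstIdeal 𝒪 K 𝔭 G ⊔ Ideal.span {1 - e}

/-- The block `kR_𝔭(G, C) = kR(G)·ē_C` of `kR(G)`, as a (unital) `k`-algebra, realized as the
quotient of `𝒪_𝔭R(G)` by `𝔭·𝒪_𝔭R(G) + (1 - e_C)·𝒪_𝔭R(G)`. -/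
abbrev blockAlg (𝒪 : Type*) (K : Type u) [CommRing 𝒪] [Field K] [Algebra 𝒪 K] (𝔭 : Ideal 𝒪)
    (G : Type u) [Group G] (e : locCharRing 𝒪 K 𝔭 G) :=
  locCharRing 𝒪 K 𝔭 G ⧸ blockIdeal 𝒪 K 𝔭 G e

/-- The constants, as a ring morphism `𝒪 →+* 𝒪_𝔭R(G)`. -/
noncomputable def constRingHom (𝒪 : Type*) (K : Type u) [CommRing 𝒪] [Field K] [Algebra 𝒪 K]
    (𝔭 : Ideal 𝒪) [𝔭.IsMaximal] (G : Type u) [Group G] : 𝒪 →+* locCharRing 𝒪 K 𝔭 G where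
  toFun a := ⟨Function.const G (algebraMap 𝒪 K a),
    Subring.subset_closure (Or.inl ⟨algebraMap 𝒪 K a,
      ⟨a, 1, fun h => (Ideal.ne_top_iff_one 𝔭).mp (Ideal.IsMaximal.ne_top ‹_›) h, by simp⟩, rfl⟩)⟩
  map_one' := Subtype.ext (funext fun g => by simp)
  map_mul' a b := Subtype.ext (funext fun g => by simp)
  map_zero' := Subtype.ext (funext fun g => by simp)
  map_add' a b := Subtype.ext (funext fun g => by simp)

/-- The structural morphism giving quotients of `𝒪_𝔭R(G)` by ideals containing
`𝔭·𝒪_𝔭R(G)` (such as `kR(G)` and its blocks) their `k = 𝒪/𝔭`-algebra structure. -/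
noncomputable def kScalars (𝒪 : Type*) (K : Type u) [CommRing 𝒪] [Field K] [Algebra 𝒪 K]
    (𝔭 : Ideal 𝒪) [𝔭.IsMaximal] (G : Type u) [Group G]
    (I : Ideal (locCharRing 𝒪 K 𝔭 G)) (hI : pConstIdeal 𝒪 K 𝔭 G ≤ I) :
    (𝒪 ⧸ 𝔭) →+* (locCharRing 𝒪 K 𝔭 G ⧸ I) :=
  Ideal.Quotient.lift 𝔭 ((Ideal.Quotient.mk I).comp (constRingHom 𝒪 K 𝔭 G))
    (fun a ha => by
      simp only [RingHom.comp_apply]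
      exact Ideal.Quotient.eq_zero_iff_mem.mpr (hI (Ideal.subset_span ⟨a, ha, rfl⟩)))

/-- The `k`-algebra structure morphism of the block `kR_𝔭(G, C)`. -/
noncomputable def blockScalars (𝒪 : Type*) (K : Type u) [CommRing 𝒪] [Field K] [Algebra 𝒪 K]
    (𝔭 : Ideal 𝒪) [𝔭.IsMaximal] (G : Type u) [Group G] (e : locCharRing 𝒪 K 𝔭 G) :
    (𝒪 ⧸ 𝔭) →+* blockAlg 𝒪 K 𝔭 G e :=
  kScalars 𝒪 K 𝔭 G (blockIdeal 𝒪 K 𝔭 G e) le_sup_left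

/-- The Jacobson radical of a ring. -/
noncomputable def jacRad (A : Type*) [CommRing A] : Ideal A := (⊥ : Ideal A).jacobson

/-- The Loewy length of `A`: the least `n` with `(Rad A) ^ n = 0`. -/
noncomputable def loewyLength (A : Type*) [CommRing A] : ℕ :=
  sInf {n : ℕ | jacRad A ^ n = ⊥}

/-- `Rad A / (Rad A)²`. -/
noncomputable abbrev radQuotient (A : Type*) [CommRing A] :=
  jacRad A ⧸ (Submodule.comap (jacRad A).subtype (jacRad A ^ 2 : Ideal A))

/-- `dim_k Rad(A)/Rad(A)²`, the `k`-vector space structure being induced by a ring morphism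
`k →+* A`. -/
noncomputable def extDim (k : Type*) [CommRing k] {A : Type*} [CommRing A] (φ : k →+* A) : ℕ :=
  letI : Module k (radQuotient A) := Module.compHom _ φ
  Module.finrank k (radQuotient A)

/-- `dim_k A`, the `k`-vector space structure being induced by a ring morphism `k →+* A`. -/
noncomputable def kDim (k : Type*) [CommRing k] {A : Type*} [CommRing A] (φ : k →+* A) : ℕ :=
  letI : Module k A := Module.compHom _ φ
  Module.finrank k A

/-- `dim_k I` for an ideal `I` of `A`, the `k`-vector space structure being induced by a ring
morphism `k →+* A`. -/
noncomputable def idealKDim (k : Type*) [CommRing k] {A : Type*} [CommRing A] (φ : k →+* A)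
    (I : Ideal A) : ℕ :=
  letI : Module k I := Module.compHom _ φ
  Module.finrank k I

section CharacterRing

open CategoryTheory MonoidalCategory

variable {K G H : Type u} [Field K] [Group G] [Group H]

theorem one_mem_charSet : (1 : G → K) ∈ charSet K G := by
  refine ⟨FDRep.of (Representation.trivial K G K), funext fun g => ?_⟩
  rw [FDRep.character, FDRep.of_ρ', Representation.isTrivial_def]
  exact (LinearMap.trace_one K K).symm ▸ by simp

theorem mul_mem_charSet {f₁ f₂ : G → K} (h₁ : f₁ ∈ charSet K G) (h₂ : f₂ ∈ charSet K G) :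
    f₁ * f₂ ∈ charSet K G := by
  obtain ⟨V, rfl⟩ := h₁
  obtain ⟨W, rfl⟩ := h₂
  exact ⟨V ⊗ W, (FDRep.char_tensor V W).symm⟩

/-- Tensor products make the character ring the additive group generated by the characters. -/
theorem mem_charRing_iff_mem_addSubgroupClosure {f : G → K} :
    f ∈ charRing K G ↔ f ∈ AddSubgroup.closure (charSet K G) := by
  let M : Submonoid (G → K) :=
    { carrier := charSet K G
      one_mem' := one_mem_charSet
      mul_mem' := mul_mem_charSet }
  rw [charRing, Subring.mem_closure_iff, show charSet K G = (M : Set (G → K)) from rfl,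
    Submonoid.closure_eq]

theorem comp_mem_charRing (π : H →* G) {f : G → K} (hf : f ∈ charRing K G) :
    f ∘ π ∈ charRing K H := by
  have hle : charRing K G ≤ (charRing K H).comap (RingHom.pi fun h => Pi.evalRingHom _ (π h)) := by
    refine Subring.closure_le.mpr ?_
    rintro _ ⟨V, rfl⟩
    exact Subring.subset_closure ⟨FDRep.of (V.ρ.comp π), rfl⟩
  exact hle hf

/-- Restriction of virtual characters along a group homomorphism. -/
def charRingRes (K : Type u) [Field K] (π : H →* G) : charRing K G →+* charRing K H where
  toFun f := ⟨(f : G → K) ∘ π, comp_mem_charRing π f.2⟩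
  map_one' := rfl
  map_mul' _ _ := rfl
  map_zero' := rfl
  map_add' _ _ := rfl

/-- Averaging a function over the fibres of a surjective group homomorphism. On characters this is
the effect of taking invariants under the kernel. -/
noncomputable def fibreAverage (K : Type u) [Field K] [Finite H] {π : H →* G}
    (hπ : Function.Surjective π) : (H → K) →+ (G → K) :=
  letI := Fintype.ofFinite π.ker
  { toFun := fun f g =>
      (Fintype.card π.ker : K)⁻¹ * ∑ n : π.ker, f (Function.surjInv hπ g * n)
    map_zero' := by ext; simp
    map_add' := fun f₁ f₂ => by ext; simp [Finset.sum_add_distrib, mul_add] }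

theorem fibreAverage_comp [CharZero K] [Finite H] {π : H →* G} (hπ : Function.Surjective π)
    (f : G → K) : fibreAverage K hπ (f ∘ π) = f := by
  let := Fintype.ofFinite π.ker
  ext g
  have hconst (n : π.ker) : (f ∘ π) (Function.surjInv hπ g * n) = f g := by
    rw [Function.comp_apply, map_mul, MonoidHom.mem_ker.mp n.2, mul_one,
      Function.surjInv_eq hπ]
  have hcard : (Fintype.card π.ker : K) ≠ 0 := Nat.cast_ne_zero.mpr Fintype.card_ne_zero
  change (Fintype.card π.ker : K)⁻¹ * ∑ n : π.ker, (f ∘ π) (Function.surjInv hπ g * n) = f g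
  simp only [hconst, Finset.sum_const, Finset.card_univ, nsmul_eq_mul]
  rw [inv_mul_cancel_left₀ hcard]

theorem fibreAverage_character [CharZero K] [Finite H] {π : H →* G} (hπ : Function.Surjective π)
    (V : FDRep K H) : fibreAverage K hπ V.character ∈ charSet K G := by
  let := Fintype.ofFinite π.ker
  have hcard : (Fintype.card π.ker : K) ≠ 0 := Nat.cast_ne_zero.mpr Fintype.card_ne_zero
  let := invertibleOfNonzero hcard
  let ρ : Representation K H V := V.ρ
  let ρN : Representation K π.ker V := ρ.comp π.ker.subtype
  let σ : Representation K G ρN.invariants :=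
    (ρ.quotientToInvariants π.ker).comp
      (QuotientGroup.quotientKerEquivOfSurjective π hπ).symm.toMonoidHom
  refine ⟨FDRep.of σ, funext fun g => ?_⟩
  obtain ⟨h, hh⟩ : ∃ h, h = Function.surjInv hπ g := ⟨_, rfl⟩
  have hg : (QuotientGroup.quotientKerEquivOfSurjective π hπ).symm g =
      (QuotientGroup.mk h : H ⧸ π.ker) := by
    rw [MulEquiv.symm_apply_eq, hh]
    exact (Function.surjInv_eq hπ g).symm
  have hσ : σ g = ρ.toInvariants π.ker h := by
    change ρ.quotientToInvariants π.ker
      ((QuotientGroup.quotientKerEquivOfSurjective π hπ).symm g) = _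
    rw [hg]
    rfl
  have hmem (x : V) : (ρ h * ρN.averageMap) x ∈ ρN.invariants :=
    (ρ.toInvariants π.ker h ⟨_, ρN.averageMap_invariant x⟩).2
  have hrestrict : ρ.toInvariants π.ker h =
      (ρ h * ρN.averageMap).restrict fun x _ => hmem x := by
    ext x
    change ρ h x = ρ h (ρN.averageMap x)
    rw [ρN.averageMap_id x x.2]
  change (Fintype.card π.ker : K)⁻¹ * ∑ n : π.ker, V.character (Function.surjInv hπ g * n) =
    LinearMap.trace K ρN.invariants (σ g)
  rw [hσ, hrestrict, LinearMap.trace_restrict_eq_of_forall_mem _ _ hmem, ← hh]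
  simp [ρN, ρ, FDRep.character, Representation.averageMap, GroupAlgebra.average, Finset.mul_sum,
    map_sum]

theorem fibreAverage_mem_charRing [CharZero K] [Finite H] {π : H →* G}
    (hπ : Function.Surjective π) {f : H → K} (hf : f ∈ charRing K H) :
    fibreAverage K hπ f ∈ charRing K G := by
  rw [mem_charRing_iff_mem_addSubgroupClosure] at hf ⊢
  have hle : AddSubgroup.closure (charSet K H) ≤
      (AddSubgroup.closure (charSet K G)).comap (fibreAverage K hπ) := by
    rw [AddSubgroup.closure_le]
    rintro _ ⟨V, rfl⟩
    exact AddSubgroup.subset_closure (fibreAverage_character hπ V)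
  exact hle hf

/-- The additive retraction of `charRingRes` given by averaging over fibres. -/
noncomputable def charRingRetraction (K : Type u) [Field K] [CharZero K] [Finite H] {π : H →* G}
    (hπ : Function.Surjective π) : charRing K H →ₗ[ℤ] charRing K G :=
  AddMonoidHom.toIntLinearMap
    { toFun := fun f => ⟨fibreAverage K hπ f, fibreAverage_mem_charRing hπ f.2⟩
      map_zero' := Subtype.ext (map_zero _)
      map_add' := fun _ _ => Subtype.ext (map_add _ _ _) }

theorem charRingRetraction_charRingRes [CharZero K] [Finite H] {π : H →* G}
    (hπ : Function.Surjective π) (f : charRing K G) :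
    charRingRetraction K hπ (charRingRes K π f) = f :=
  Subtype.ext (fibreAverage_comp hπ (f : G → K))

end CharacterRing

section Finiteness

theorem Matrix.trace_mem_adjoin_of_pow_eq_one_of_isAlgClosed {L ι : Type*} [Field L]
    [IsAlgClosed L] [Fintype ι] [DecidableEq ι] {n : ℕ} [NeZero n] {ζ : L}
    (hζ : IsPrimitiveRoot ζ n) {A : Matrix ι ι L} (hA : A ^ n = 1) :
    A.trace ∈ Algebra.adjoin ℤ {ζ} := by
  rw [Matrix.trace_eq_sum_roots_charpoly]
  refine multiset_sum_mem _ fun μ hμ => ?_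
  have hroot : Module.End.HasEigenvalue (Matrix.toLin' A) μ := by
    rw [Module.End.hasEigenvalue_iff_isRoot_charpoly, Matrix.charpoly_toLin']
    exact (Polynomial.mem_roots'.mp hμ).2
  obtain ⟨v, hv⟩ := hroot.exists_hasEigenvector
  have hpow : μ ^ n = 1 := by
    have h := hv.pow_apply n
    rw [← Matrix.toLin'_pow, hA, Matrix.toLin'_one, LinearMap.id_apply] at h
    have h' : (μ ^ n - 1) • v = 0 := by rw [sub_smul, one_smul, ← h, sub_self]
    exact sub_eq_zero.mp ((smul_eq_zero.mp h').resolve_right hv.2)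
  obtain ⟨i, -, rfl⟩ := hζ.eq_pow_of_pow_eq_one hpow
  exact pow_mem (Algebra.self_mem_adjoin_singleton ℤ ζ) i

theorem Matrix.trace_mem_adjoin_of_pow_eq_one {K ι : Type*} [Field K] [Fintype ι] [DecidableEq ι]
    {n : ℕ} [NeZero n] {ζ : K} (hζ : IsPrimitiveRoot ζ n) {M : Matrix ι ι K} (hM : M ^ n = 1) :
    M.trace ∈ Algebra.adjoin ℤ {ζ} := by
  obtain ⟨L, _, _, ⟨ψ⟩⟩ : ∃ (L : Type _) (_ : Field L) (_ : IsAlgClosed L), Nonempty (K →+* L) :=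
    ⟨AlgebraicClosure K, inferInstance, inferInstance, ⟨algebraMap _ _⟩⟩
  let φ : K →ₐ[ℤ] L := ψ.toIntAlgHom
  have hφ : Function.Injective φ := ψ.injective
  have hA : φ.mapMatrix M ^ n = 1 := by rw [← map_pow, hM, map_one]
  have hmem := trace_mem_adjoin_of_pow_eq_one_of_isAlgClosed (hζ.map_of_injective hφ) hA
  rw [← Set.image_singleton, ← AlgHom.map_adjoin] at hmem
  obtain ⟨x, hx, hxA⟩ := hmem
  have htr : (φ.mapMatrix M).trace = φ M.trace := (AddMonoidHom.map_trace φ M).symm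
  rwa [← hφ (hxA.trans htr)]

theorem LinearMap.trace_mem_adjoin_of_pow_eq_one {K V : Type*} [Field K] [AddCommGroup V]
    [Module K V] [Module.Finite K V] {n : ℕ} [NeZero n] {ζ : K} (hζ : IsPrimitiveRoot ζ n)
    {f : Module.End K V} (hf : f ^ n = 1) : LinearMap.trace K V f ∈ Algebra.adjoin ℤ {ζ} := by
  rw [LinearMap.trace_eq_matrix_trace K (Module.finBasis K V)]
  refine Matrix.trace_mem_adjoin_of_pow_eq_one hζ ?_
  rw [LinearMap.toMatrix_pow, hf, LinearMap.toMatrix_one]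

variable {K G : Type u} [Field K] [Group G]

theorem apply_mem_adjoin_of_mem_charRing [Finite G] {n : ℕ} [NeZero n]
    (hn : Nat.card G ∣ n) {ζ : K} (hζ : IsPrimitiveRoot ζ n) {f : G → K} (hf : f ∈ charRing K G)
    (g : G) : f g ∈ Algebra.adjoin ℤ {ζ} := by
  have hle : charRing K G ≤ (Algebra.adjoin ℤ {ζ}).toSubring.comap (Pi.evalRingHom _ g) := by
    refine Subring.closure_le.mpr ?_
    rintro _ ⟨V, rfl⟩
    have hg : g ^ n = 1 := orderOf_dvd_iff_pow_eq_one.mp ((orderOf_dvd_natCard g).trans hn)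
    change LinearMap.trace K V (V.ρ g) ∈ Algebra.adjoin ℤ {ζ}
    exact LinearMap.trace_mem_adjoin_of_pow_eq_one hζ (by rw [← map_pow, hg, map_one])
  exact hle hf

/-- Over a field containing enough roots of unity, the character ring of a finite group is a
finitely generated abelian group, since its members take values in a cyclotomic ring. -/
theorem charRing_finite [Finite G] {n : ℕ} [NeZero n] (hn : Nat.card G ∣ n) {ζ : K}
    (hζ : IsPrimitiveRoot ζ n) : Module.Finite ℤ (charRing K G) := by
  have : Module.Finite ℤ (Algebra.adjoin ℤ {ζ}) :=
    Module.Finite.iff_fg.mpr (hζ.isIntegral (NeZero.pos n)).fg_adjoin_singleton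
  let ev : charRing K G →+ (G → Algebra.adjoin ℤ {ζ}) :=
    { toFun := fun f g => ⟨(f : G → K) g, apply_mem_adjoin_of_mem_charRing hn hζ f.2 g⟩
      map_zero' := rfl
      map_add' := fun _ _ => rfl }
  refine Module.Finite.of_injective ev.toIntLinearMap fun f₁ f₂ h => ?_
  exact Subtype.ext (funext fun g => congrArg Subtype.val (congrFun h g))

end Finiteness

/-- The Loewy length does not increase when passing to an Artinian subring. -/
theorem loewyLength_le_of_injective {A B : Type*} [CommRing A] [CommRing B] [IsArtinianRing A]
    [IsArtinianRing B] (φ : A →+* B) (hφ : Function.Injective φ) :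
    loewyLength A ≤ loewyLength B := by
  have hB : jacRad B ^ loewyLength B = ⊥ :=
    Nat.sInf_mem (s := {n : ℕ | jacRad B ^ n = ⊥}) IsArtinianRing.isNilpotent_jacobson_bot
  have hmap : (jacRad A).map φ ≤ jacRad B := by
    rw [Ideal.map_le_iff_le_comap]
    intro a ha
    obtain ⟨m, hm⟩ : IsNilpotent (jacRad A) := IsArtinianRing.isNilpotent_jacobson_bot
    have ham : a ^ m = 0 := by
      have h := Ideal.pow_mem_pow ha m
      rwa [hm] at h
    exact Ideal.radical_le_jacobson ⟨m, by rw [← map_pow, ham, map_zero]; exact zero_mem _⟩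
  refine Nat.sInf_le ?_
  rw [Set.mem_ofPred_eq, ← le_bot_iff, ← Ideal.comap_bot_of_injective φ hφ,
    ← Ideal.map_le_iff_le_comap, Ideal.map_pow]
  exact (Ideal.pow_right_mono hmap _).trans hB.le

variable {𝒪 : Type*} [CommRing 𝒪] [IsDomain 𝒪] [IsDedekindDomain 𝒪] [CharZero 𝒪]
variable {K : Type u} [Field K] [Algebra 𝒪 K] [IsFractionRing 𝒪 K]
variable {𝔭 : Ideal 𝒪} [𝔭.IsMaximal]

/-- Let `π : H → G` be a surjective homomorphism of finite groups.  Then the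
restriction map `Res_π : R(G) → R(H)`, `f ↦ f ∘ π`, is an injective ring homomorphism whose
image is a direct summand of the `ℤ`-module `R(H)`; consequently the induced `k`-algebra
homomorphism `kR(G) → kR(H)` (where `k = 𝒪/𝔭`) is injective, and `ℓ_p(G) ≤ ℓ_p(H)`. -/
theorem restriction_along_surjection_injective
    (p : ℕ) [Fact p.Prime] (hp : (p : 𝒪) ∈ 𝔭)
    {G H : Type u} [Group G] [Group H] [Finite G] [Finite H]
    (ζ : K) (hζ : IsPrimitiveRoot ζ (Nat.card G * Nat.card H))
    (π : H →* G) (hπ : Function.Surjective π) :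
    ∃ Φ : charRing K G →+* charRing K H,
      (∀ f : charRing K G, (Φ f : H → K) = (f : G → K) ∘ π) ∧
      Function.Injective Φ ∧
      (∃ N : Submodule ℤ (charRing K H),
        IsCompl (LinearMap.range Φ.toIntAlgHom.toLinearMap) N) ∧
      Function.Injective
        (Algebra.TensorProduct.map (AlgHom.id ℤ (𝒪 ⧸ 𝔭)) Φ.toIntAlgHom :
          (𝒪 ⧸ 𝔭) ⊗[ℤ] charRing K G →ₐ[ℤ] (𝒪 ⧸ 𝔭) ⊗[ℤ] charRing K H) ∧
      loewyLength ((𝒪 ⧸ 𝔭) ⊗[ℤ] charRing K G) ≤ loewyLength ((𝒪 ⧸ 𝔭) ⊗[ℤ] charRing K H) := by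
  have : CharZero K := charZero_of_injective_algebraMap (IsFractionRing.injective 𝒪 K)
  have : NeZero (Nat.card G * Nat.card H) := ⟨mul_ne_zero Nat.card_pos.ne' Nat.card_pos.ne'⟩
  have := charRing_finite (Dvd.intro _ rfl) hζ (G := G)
  have := charRing_finite (Dvd.intro_left _ rfl) hζ (G := H)
  let ι : charRing K G →ₗ[ℤ] charRing K H := (charRingRes K π).toIntAlgHom.toLinearMap
  have hι : (charRingRetraction K hπ).comp ι = LinearMap.id :=
    LinearMap.ext (charRingRetraction_charRingRes hπ)
  have hcompl : IsCompl (LinearMap.range ι)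
      (LinearMap.ker (ι.rangeRestrict.comp (charRingRetraction K hπ))) := by
    refine LinearMap.isCompl_of_proj ?_
    rintro ⟨_, f, rfl⟩
    exact Subtype.ext (congrArg ι (LinearMap.congr_fun hι f))
  have htensor : Function.Injective
      (Algebra.TensorProduct.map (AlgHom.id ℤ (𝒪 ⧸ 𝔭)) (charRingRes K π).toIntAlgHom) := by
    refine Function.LeftInverse.injective (g := (charRingRetraction K hπ).lTensor (𝒪 ⧸ 𝔭))
      fun x => ?_
    change ((charRingRetraction K hπ).lTensor (𝒪 ⧸ 𝔭)) (ι.lTensor (𝒪 ⧸ 𝔭) x) = x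
    rw [← LinearMap.lTensor_comp_apply, hι, LinearMap.lTensor_id_apply]
  refine ⟨charRingRes K π, fun _ => rfl,
    Function.LeftInverse.injective (charRingRetraction_charRingRes hπ),
    ⟨_, hcompl⟩, htensor, ?_⟩
  let := Ideal.Quotient.field 𝔭
  have : IsArtinianRing ((𝒪 ⧸ 𝔭) ⊗[ℤ] charRing K G) := IsArtinianRing.of_finite (𝒪 ⧸ 𝔭) _
  have : IsArtinianRing ((𝒪 ⧸ 𝔭) ⊗[ℤ] charRing K H) := IsArtinianRing.of_finite (𝒪 ⧸ 𝔭) _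
  exact loewyLength_le_of_injective (Algebra.TensorProduct.map (AlgHom.id ℤ (𝒪 ⧸ 𝔭))
    (charRingRes K π).toIntAlgHom).toRingHom htensor
end

section
/- For any two elements g, h ∈ G, the images of χ(g) and χ(h) in k = 𝒪/𝔭 coincide for every virtual character χ ∈ R(G) if and only if the p'-parts g_{p'} and h_{p'} are conjugate in G. -/
open scoped TensorProduct Classical

/-- The traces of the powers of an endomorphism of order dividing `n`, in terms of the
multiplicities `r i` of its eigenvalues `ξ ^ i`. -/
theorem LinearMap.exists_trace_pow_eq_sum {K V : Type*} [Field K] [AddCommGroup V] [Module K V]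
    [FiniteDimensional K V] {n : ℕ} (hn : 0 < n) {ξ : K} (hξ : IsPrimitiveRoot ξ n)
    {T : Module.End K V} (hT : T ^ n = 1) :
    ∃ r : ℕ → ℕ, ∀ m : ℕ,
      LinearMap.trace K V (T ^ m) = ∑ i ∈ Finset.range n, (r i : K) * (ξ ^ i) ^ m := by
  have : NeZero n := ⟨hn.ne'⟩
  have hn0 : (n : K) ≠ 0 := hξ.neZero'.out
  have hξ0 : ξ ≠ 0 := hξ.ne_zero hn.ne'
  have hξn (i : ℕ) : (ξ ^ i) ^ n = 1 := by rw [pow_right_comm, hξ.pow_eq_one, one_pow]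
  let F (i j : ℕ) : Module.End K V := ((ξ ^ i)⁻¹ ^ j) • T ^ j
  let e (i : ℕ) : Module.End K V := (n : K)⁻¹ • ∑ j ∈ Finset.range n, F i j
  have hF (i j : ℕ) : T * F i j = ξ ^ i • F i (j + 1) := by
    simp only [F, mul_smul_comm, ← pow_succ', smul_smul]
    congr 1
    rw [pow_succ']
    field_simp
  have hFn (i : ℕ) : F i n = F i 0 := by simp [F, hT, hξn]
  have hTe (i : ℕ) : T * e i = ξ ^ i • e i := by
    simp only [e, mul_smul_comm, Finset.mul_sum, hF, ← Finset.smul_sum]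
    rw [smul_comm]
    congr 2
    have h := Finset.sum_range_succ (F i) n
    rw [Finset.sum_range_succ', hFn] at h
    exact add_right_cancel h
  have hTme (i m : ℕ) : T ^ m * e i = (ξ ^ i) ^ m • e i := by
    induction m with
    | zero => simp
    | succ m ih => rw [pow_succ, mul_assoc, hTe, mul_smul_comm, ih, smul_smul, pow_succ']
  have he (i : ℕ) : IsIdempotentElem (e i) := by
    have h : ∀ j, F i j * e i = e i := fun j => by
      simp only [F, smul_mul_assoc, hTme, smul_smul]
      rw [← mul_pow, inv_mul_cancel₀ (pow_ne_zero _ hξ0), one_pow, one_smul]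
    change ((n : K)⁻¹ • ∑ j ∈ Finset.range n, F i j) * e i = e i
    rw [smul_mul_assoc, Finset.sum_mul, Finset.sum_congr rfl fun j _ => h j, Finset.sum_const,
      Finset.card_range, ← Nat.cast_smul_eq_nsmul K, smul_smul, inv_mul_cancel₀ hn0, one_smul]
  have hsum : ∑ i ∈ Finset.range n, e i = 1 := by
    have h : ∀ j ∈ Finset.range n,
        ∑ i ∈ Finset.range n, F i j = if j = 0 then (n : K) • 1 else 0 := by
      intro j hj
      simp only [F, ← Finset.sum_smul]
      split_ifs with h0
      · simp [h0]
      · have h1 : ξ⁻¹ ^ j ≠ 1 := hξ.inv.pow_ne_one_of_pos_of_lt h0 (Finset.mem_range.1 hj)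
        have h2 : ∑ i ∈ Finset.range n, (ξ ^ i)⁻¹ ^ j = ∑ i ∈ Finset.range n, (ξ⁻¹ ^ j) ^ i :=
          Finset.sum_congr rfl fun i _ => by rw [← inv_pow, pow_right_comm]
        rw [h2, geom_sum_eq h1, pow_right_comm, hξ.inv.pow_eq_one]
        simp
    simp only [e, ← Finset.smul_sum]
    rw [Finset.sum_comm, Finset.sum_congr rfl h]
    simp [hn, smul_smul, hn0]
  refine ⟨fun i => Module.finrank K (LinearMap.range (e i)), fun m => ?_⟩
  conv_lhs => rw [← mul_one (T ^ m), ← hsum, Finset.mul_sum, map_sum]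
  refine Finset.sum_congr rfl fun i _ => ?_
  rw [hTme, map_smul, (LinearMap.IsIdempotentElem.isProj_range _ (he i)).trace, smul_eq_mul,
    mul_comm]

/-- The `p'`-part of `g` is the power `g ^ m` for some `m` which is `0` modulo the `p`-part and
`1` modulo the `p'`-part of the order of `g`. -/
theorem exists_pPrimePart_eq_pow (p : ℕ) [Fact p.Prime] {G : Type*} [Group G] [Finite G] (g : G) :
    ∃ v c m : ℕ, orderOf g = p ^ v * c ∧ c.Coprime p ∧ p ^ v ∣ m ∧ m ≡ 1 [MOD c] ∧
      pPrimePart p g = g ^ m := by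
  have hp : p.Prime := Fact.out
  have hg : orderOf g ≠ 0 := (orderOf_pos g).ne'
  refine ⟨_, _, _, (Nat.ordProj_mul_ordCompl_eq_self (orderOf g) p).symm,
    (Nat.coprime_ordCompl hp hg).symm, dvd_mul_right _ _, ?_, rfl⟩
  have : NeZero (orderOf g / p ^ (orderOf g).factorization p) :=
    ⟨(Nat.ordCompl_pos p hg).ne'⟩
  rw [← ZMod.natCast_eq_natCast_iff]
  push_cast
  rw [ZMod.natCast_zmod_val]
  have h := ZMod.coe_mul_inv_eq_one (n := orderOf g / p ^ (orderOf g).factorization p)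
    (p ^ (orderOf g).factorization p) ((Nat.coprime_ordCompl hp hg).pow_left _)
  push_cast at h
  exact h

/-- The `p'`-part of an element is `p`-regular. -/
theorem coprime_orderOf_pPrimePart (p : ℕ) [Fact p.Prime] {G : Type*} [Group G] [Finite G]
    (g : G) : (orderOf (pPrimePart p g)).Coprime p := by
  obtain ⟨v, c, m, hn, hc, ⟨w, rfl⟩, -, h⟩ := exists_pPrimePart_eq_pow p g
  refine hc.coprime_dvd_left (orderOf_dvd_of_pow_eq_one ?_)
  rw [h, ← pow_mul, mul_right_comm, ← hn, pow_mul, pow_orderOf_eq_one, one_pow]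

/-- Raising to the power that computes the `p'`-part does not change a root of unity modulo `p`. -/
theorem exists_pPrimePart_eq_pow_and_pow_eq {p : ℕ} [Fact p.Prime] {k : Type*} [CommRing k]
    [IsDomain k] [CharP k p] {G : Type*} [Group G] [Finite G] (g : G) :
    ∃ m : ℕ, pPrimePart p g = g ^ m ∧ ∀ x : k, x ^ orderOf g = 1 → x ^ m = x := by
  obtain ⟨v, c, m, hn, -, -, hm, h⟩ := exists_pPrimePart_eq_pow p g
  refine ⟨m, h, fun x hx => iterateFrobenius_inj k p v ?_⟩
  have hmod : m * p ^ v ≡ p ^ v [MOD orderOf g] := by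
    rw [hn, mul_comm m]
    simpa using hm.mul_left' (p ^ v)
  rw [iterateFrobenius_def, iterateFrobenius_def, ← pow_mul]
  exact pow_eq_pow_of_modEq hmod hx

/-- The character of the representation induced from a one-dimensional representation `θ` along a
group homomorphism `φ`. -/
theorem FDRep.exists_character_induced {K G : Type u} [Field K] [CharZero K] [Group G] [Fintype G]
    {A : Type*} [Group A] [Fintype A] (φ : A →* G) (θ : A →* K) :
    ∃ V : FDRep K G, ∀ s : G, (Fintype.card A : K) * V.character s =
      ∑ a, ∑ y, if y * φ a * y⁻¹ = s then θ a else 0 := by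
  have hA : (Fintype.card A : K) ≠ 0 := Nat.cast_ne_zero.2 Fintype.card_ne_zero
  let ρ : Representation K G (G → K) :=
    { toFun := fun s => LinearMap.funLeft K K fun y => s⁻¹ * y
      map_one' := by ext; simp [LinearMap.funLeft]
      map_mul' := fun s t => by
        ext f y
        simp [LinearMap.funLeft, mul_assoc] }
  have hρ (s : G) (f : G → K) (y : G) : ρ s f y = f (s⁻¹ * y) := rfl
  let W : Submodule K (G → K) :=
    { carrier := {f | ∀ a y, θ a * f (y * φ a) = f y}
      zero_mem' := by simp
      add_mem' := fun hf hg a y => by simp [mul_add, hf a y, hg a y]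
      smul_mem' := fun c f hf a y => by
        simp only [Pi.smul_apply, smul_eq_mul, mul_left_comm, hf a y] }
  have hW (s : G) : W ≤ W.comap (ρ s) := fun f hf a y => by
    simpa only [hρ, mul_assoc] using hf a (s⁻¹ * y)
  let e : (G → K) →ₗ[K] (G → K) :=
    (Fintype.card A : K)⁻¹ • ∑ a, θ a • LinearMap.funLeft K K fun y => y * φ a
  have he (f : G → K) (y : G) :
      e f y = (Fintype.card A : K)⁻¹ * ∑ a, θ a * f (y * φ a) := by
    simp [e, LinearMap.funLeft]
  have heW (f : G → K) : e f ∈ W := fun b y => by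
    rw [he, he, mul_left_comm, Finset.mul_sum]
    congr 1
    refine Fintype.sum_equiv (Equiv.mulLeft b) _ _ fun a => ?_
    simp [mul_assoc]
  have heid (f : G → K) (hf : f ∈ W) : e f = f := by
    ext y
    rw [he, Finset.sum_congr rfl fun a _ => hf a y]
    simp [hA]
  refine ⟨FDRep.of (ρ.subrepresentation W hW), fun s => ?_⟩
  have hmem : ∀ f, (ρ s ∘ₗ e) f ∈ W := fun f => hW s (heW f)
  have h1 : (FDRep.of (ρ.subrepresentation W hW)).character s =
      LinearMap.trace K (G → K) (ρ s ∘ₗ e) := by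
    rw [← LinearMap.trace_restrict_eq_of_forall_mem W _ hmem]
    change LinearMap.trace K W (ρ.subrepresentation W hW s) = _
    congr 1
    ext f : 2
    change ρ s f = ρ s (e f)
    rw [heid f f.2]
  rw [h1, LinearMap.trace_eq_matrix_trace K (Pi.basisFun K G), Matrix.trace, Finset.mul_sum,
    Finset.sum_comm]
  refine Finset.sum_congr rfl fun y _ => ?_
  simp only [Matrix.diag_apply, LinearMap.toMatrix_apply, Pi.basisFun_apply, Pi.basisFun_repr,
    LinearMap.comp_apply, hρ, he]
  rw [mul_inv_cancel_left₀ hA]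
  refine Finset.sum_congr rfl fun a _ => ?_
  have : s⁻¹ * y * φ a = y ↔ y * φ a * y⁻¹ = s := by
    rw [mul_assoc, inv_mul_eq_iff_eq_mul, mul_inv_eq_iff_eq_mul]
  simp [Pi.single_apply, this]

/-- An `𝒪`-linear combination of induced characters counting the conjugates of `s` in the coset
`x P`, where `P` is a subgroup centralizing `x`. -/
theorem FDRep.exists_sum_character_eq_card {K G : Type u} [Field K] [CharZero K] [Group G]
    [Fintype G] (x : G) (P : Subgroup G) (hP : ∀ u ∈ P, Commute x u) {ξ : K}
    (hξ : IsPrimitiveRoot ξ (orderOf x)) :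
    ∃ V : ℕ → FDRep K G, ∀ s : G,
      (Nat.card P : K) * ∑ j ∈ Finset.range (orderOf x), ξ⁻¹ ^ j * (V j).character s =
        Nat.card {z : P × G // z.2 * (x * z.1) * z.2⁻¹ = s} := by
  have hn0 : (orderOf x : K) ≠ 0 := Nat.cast_ne_zero.2 (orderOf_pos x).ne'
  have hξ0 : ξ ≠ 0 := hξ.ne_zero (orderOf_pos x).ne'
  let x' : Subgroup.zpowers x := ⟨x, Subgroup.mem_zpowers x⟩
  have hx' : ∀ a : Subgroup.zpowers x, a ∈ Subgroup.zpowers x' := by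
    rintro ⟨_, i, rfl⟩
    exact ⟨i, by ext; simp [x']⟩
  have hox : orderOf x' = orderOf x := Subgroup.orderOf_mk x _
  let ξu : Kˣ := Units.mk0 ξ hξ0
  have hξu : IsPrimitiveRoot ξu (orderOf x) := IsPrimitiveRoot.coe_units_iff.1 hξ
  let τ : Subgroup.zpowers x →* Kˣ :=
    monoidHomOfForallMemZpowers (g := x') (g' := ξu) hx' (by rw [hox, ← hξu.eq_orderOf])
  have hτx : τ x' = ξu := monoidHomOfForallMemZpowers_apply_gen hx' _
  have hτ (a : Subgroup.zpowers x) : (τ a : K) = ξ ↔ a = x' := by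
    refine ⟨fun h => ?_, fun h => by rw [h, hτx]; rfl⟩
    obtain ⟨i, rfl⟩ := hx' a
    have h' : ξu ^ i = ξu ^ (1 : ℤ) := by
      rw [zpow_one, ← hτx, ← map_zpow]
      exact Units.ext (h.trans (by rw [hτx]; rfl))
    have h2 := hξu.eq_orderOf ▸ (zpow_eq_zpow_iff_modEq.1 h')
    have : x' ^ i = x' ^ (1 : ℤ) := zpow_eq_zpow_iff_modEq.2 (hox ▸ h2)
    simpa using this
  let φ : Subgroup.zpowers x × P →* G :=
    (Subgroup.zpowers x).subtype.noncommCoprod P.subtype <| by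
      rintro ⟨_, i, rfl⟩ u
      exact (hP u u.2).zpow_left i
  let θ (j : ℕ) : Subgroup.zpowers x × P →* K :=
    (((Units.coeHom K).comp τ).comp (MonoidHom.fst _ _)) ^ j
  choose V hV using fun j => FDRep.exists_character_induced φ (θ j)
  refine ⟨V, fun s => mul_left_cancel₀ hn0 ?_⟩
  have hcard : (Fintype.card (Subgroup.zpowers x × P) : K) = orderOf x * Nat.card P := by
    rw [Fintype.card_prod, Fintype.card_zpowers, ← Nat.card_eq_fintype_card (α := P)]
    push_cast
    rfl
  have horth (a : Subgroup.zpowers x × P) :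
      ∑ j ∈ Finset.range (orderOf x), ξ⁻¹ ^ j * θ j a = if a.1 = x' then (orderOf x : K) else 0 := by
    have h1 : ∀ j, ξ⁻¹ ^ j * θ j a = (ξ⁻¹ * (τ a.1 : K)) ^ j := fun j => by
      rw [mul_pow]; rfl
    rw [Finset.sum_congr rfl fun j _ => h1 j]
    split_ifs with h
    · rw [(hτ _).2 h, inv_mul_cancel₀ hξ0]
      simp
    · have hne : ξ⁻¹ * (τ a.1 : K) ≠ 1 := fun h2 =>
        h ((hτ _).1 ((inv_mul_eq_one₀ hξ0).1 h2).symm)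
      have hpow : (τ a.1 : K) ^ orderOf x = 1 := by
        rw [← Units.val_pow_eq_pow_val, ← map_pow, ← Nat.card_zpowers, pow_card_eq_one', map_one,
          Units.val_one]
      rw [geom_sum_eq hne, mul_pow, hpow, inv_pow, hξ.pow_eq_one]
      simp
  calc (orderOf x : K) * (Nat.card P *
        ∑ j ∈ Finset.range (orderOf x), ξ⁻¹ ^ j * (V j).character s)
      = ∑ j ∈ Finset.range (orderOf x), ξ⁻¹ ^ j *
          ∑ a, ∑ y, if y * φ a * y⁻¹ = s then θ j a else 0 := by
        rw [← mul_assoc, ← hcard, Finset.mul_sum]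
        exact Finset.sum_congr rfl fun j _ => by rw [mul_left_comm, hV]
    _ = ∑ a, ∑ y, if y * φ a * y⁻¹ = s then
          ∑ j ∈ Finset.range (orderOf x), ξ⁻¹ ^ j * θ j a else 0 := by
        simp only [Finset.mul_sum]
        rw [Finset.sum_comm]
        refine Finset.sum_congr rfl fun a _ => ?_
        rw [Finset.sum_comm]
        refine Finset.sum_congr rfl fun y _ => ?_
        split_ifs <;> simp
    _ = ∑ u : P, ∑ y, if y * (x * u) * y⁻¹ = s then (orderOf x : K) else 0 := by
        simp only [horth]
        rw [Fintype.sum_prod_type, Finset.sum_eq_single x']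
        · simp [φ, x']
        · intro b _ hb
          simp [hb]
        · simp
    _ = _ := by
        rw [Nat.card_eq_fintype_card, Fintype.card_subtype, ← Fintype.sum_prod_type',
          ← Finset.sum_filter, Finset.sum_const, nsmul_eq_mul, mul_comm]

/-- If a `p`-regular element is conjugate to the product of a `p`-regular element with a commuting
`p`-element, then this `p`-element is trivial. -/
theorem eq_one_of_conj_mul_eq {p : ℕ} {G : Type*} [Group G] {x s u y : G}
    (hx : (orderOf x).Coprime p) (hs : (orderOf s).Coprime p) (hu : ∃ n, u ^ p ^ n = 1)
    (hxu : Commute x u) (h : y * (x * u) * y⁻¹ = s) : u = 1 := by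
  obtain ⟨n, hn⟩ := hu
  have h1 : u ^ (orderOf x * orderOf s) = 1 := by
    have h2 : (x * u) ^ orderOf s = 1 := by
      have h3 := pow_orderOf_eq_one s
      nth_rw 1 [← h] at h3
      rwa [conj_pow, conj_eq_one_iff] at h3
    have h4 : (x * u) ^ (orderOf x * orderOf s) = 1 := by rw [mul_comm, pow_mul, h2, one_pow]
    rwa [hxu.mul_pow, pow_mul, pow_orderOf_eq_one, one_pow, one_mul] at h4
  have h5 := Nat.dvd_gcd (orderOf_dvd_of_pow_eq_one h1) (orderOf_dvd_of_pow_eq_one hn)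
  rw [Nat.Coprime.gcd_eq_one ((hx.mul_left hs).pow_right n)] at h5
  exact orderOf_eq_one_iff.1 (Nat.dvd_one.1 h5)

/-- Two `p`-regular elements at which all characters are congruent modulo `𝔭` are conjugate. -/
theorem isConj_of_forall_character_sub_mem {𝒪 : Type*} {K G : Type u} [CommRing 𝒪]
    [IsIntegrallyClosed 𝒪] [Field K] [CharZero K] [Algebra 𝒪 K] [IsFractionRing 𝒪 K]
    {𝔭 : Ideal 𝒪} (h𝔭 : 𝔭 ≠ ⊤) {p : ℕ} [Fact p.Prime] (hp : (p : 𝒪) ∈ 𝔭) [Group G] [Finite G]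
    {x s : G} (hx : (orderOf x).Coprime p) (hs : (orderOf s).Coprime p) {ξ : K}
    (hξ : IsPrimitiveRoot ξ (orderOf x))
    (h : ∀ V : FDRep K G, ∃ a b : 𝒪, V.character x = algebraMap 𝒪 K a ∧
      V.character s = algebraMap 𝒪 K b ∧ a - b ∈ 𝔭) : IsConj x s := by
  have := Fintype.ofFinite G
  by_contra hxs
  let C : Subgroup G := Subgroup.centralizer {x}
  let P : Sylow p C := default
  let Q : Subgroup G := (P : Subgroup C).map C.subtype
  have hQC : ∀ u ∈ Q, Commute x u := by
    rintro _ ⟨u, -, rfl⟩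
    exact (Subgroup.mem_centralizer_singleton_iff.1 u.2).symm
  have hQp : ∀ u ∈ Q, ∃ n, u ^ p ^ n = 1 := by
    rintro _ ⟨u, hu, rfl⟩
    obtain ⟨n, hn⟩ := P.2 ⟨u, hu⟩
    exact ⟨n, by simpa using congr_arg (fun v : P => ((v : C) : G)) hn⟩
  have hQ0 : (Nat.card Q : K) ≠ 0 := Nat.cast_ne_zero.2 Nat.card_pos.ne'
  have hcard : Nat.card Q * (P : Subgroup C).index = Nat.card C := by
    rw [Subgroup.card_subtype, Subgroup.card_mul_index]
  obtain ⟨V, hV⟩ := FDRep.exists_sum_character_eq_card x Q hQC hξ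
  have hVs : ∑ j ∈ Finset.range (orderOf x), ξ⁻¹ ^ j * (V j).character s = 0 := by
    refine (mul_eq_zero.1 ((hV s).trans ?_)).resolve_left hQ0
    have : IsEmpty {z : Q × G // z.2 * (x * z.1) * z.2⁻¹ = s} := by
      refine ⟨fun ⟨⟨u, y⟩, hz⟩ => hxs (isConj_iff.2 ⟨y, ?_⟩)⟩
      have hu := eq_one_of_conj_mul_eq hx hs (hQp u u.2) (hQC u u.2) hz
      simpa [hu] using hz
    simp
  have hVx : ∑ j ∈ Finset.range (orderOf x), ξ⁻¹ ^ j * (V j).character x =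
      (P : Subgroup C).index := by
    refine mul_left_cancel₀ hQ0 ((hV x).trans ?_)
    rw [← Nat.cast_mul, hcard]
    congr 1
    refine Nat.card_congr
      { toFun := fun z => ⟨z.1.2, ?_⟩
        invFun := fun y => ⟨(1, y), ?_⟩
        left_inv := ?_
        right_inv := fun y => rfl }
    · obtain ⟨⟨u, y⟩, hz⟩ := z
      have hu := eq_one_of_conj_mul_eq hx hx (hQp u u.2) (hQC u u.2) hz
      simp only [hu, mul_one] at hz
      exact Subgroup.mem_centralizer_singleton_iff.2 (mul_inv_eq_iff_eq_mul.1 hz)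
    · have := Subgroup.mem_centralizer_singleton_iff.1 y.2
      simp [this]
    · rintro ⟨⟨u, y⟩, hz⟩
      have hu := eq_one_of_conj_mul_eq hx hx (hQp u u.2) (hQC u u.2) hz
      ext
      · exact hu.symm
      · rfl
  choose a b ha hb hab using h
  obtain ⟨w, hw⟩ : ∃ w : 𝒪, algebraMap 𝒪 K w = ξ⁻¹ :=
    IsIntegrallyClosed.isIntegral_iff.1 (hξ.inv.isIntegral (orderOf_pos x)).tower_top
  have hinj := IsFractionRing.injective 𝒪 K
  have hsum : ∑ j ∈ Finset.range (orderOf x), w ^ j * (a (V j) - b (V j)) =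
      ((P : Subgroup C).index : 𝒪) := by
    refine hinj ?_
    simp only [map_sum, map_mul, map_pow, map_sub, hw, ← ha, ← hb, mul_sub, Finset.sum_sub_distrib,
      hVs, hVx, sub_zero, map_natCast]
  have hmem : ((P : Subgroup C).index : 𝒪) ∈ 𝔭 :=
    hsum ▸ Ideal.sum_mem _ fun j _ => Ideal.mul_mem_left _ _ (hab _)
  have hcop : IsCoprime (p : ℤ) ((P : Subgroup C).index : ℤ) :=
    Nat.isCoprime_iff_coprime.2 ((Fact.out : p.Prime).coprime_iff_not_dvd.2 P.not_dvd_index)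
  obtain ⟨c, d, hcd⟩ := hcop
  refine h𝔭 ((Ideal.eq_top_iff_one _).2 ?_)
  have h1 : (c : 𝒪) * p + d * (P : Subgroup C).index = 1 := by
    exact_mod_cast congr_arg (Int.cast : ℤ → 𝒪) hcd
  exact h1 ▸ Ideal.add_mem _ (Ideal.mul_mem_left _ _ hp) (Ideal.mul_mem_left _ _ hmem)

/-- Virtual characters are class functions. -/
theorem charRing_apply_eq_of_isConj {K G : Type u} [Field K] [Group G] {f : G → K}
    (hf : f ∈ charRing K G) {g h : G} (hgh : IsConj g h) : f g = f h := by
  induction hf using Subring.closure_induction with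
  | mem f hf =>
    obtain ⟨V, rfl⟩ := hf
    obtain ⟨c, rfl⟩ := isConj_iff.1 hgh
    exact (V.char_conj g c).symm
  | zero => rfl
  | one => rfl
  | add f₁ f₂ _ _ h₁ h₂ => simp [h₁, h₂]
  | neg f _ h => simp [h]
  | mul f₁ f₂ _ _ h₁ h₂ => simp [h₁, h₂]

/-- The value of a character at `g` is integral, and congruent modulo `𝔭` to its value at the
`p'`-part of `g`. -/
theorem exists_character_pPrimePart_sub_mem {𝒪 : Type*} {K G : Type u} [CommRing 𝒪]
    [IsIntegrallyClosed 𝒪] [Field K] [Algebra 𝒪 K] [IsFractionRing 𝒪 K]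
    {𝔭 : Ideal 𝒪} [𝔭.IsPrime] {p : ℕ} [Fact p.Prime] (hp : (p : 𝒪) ∈ 𝔭) [Group G] [Finite G]
    {ζ : K} (hζ : IsPrimitiveRoot ζ (Nat.card G)) (g : G) (V : FDRep K G) :
    ∃ a b : 𝒪, V.character g = algebraMap 𝒪 K a ∧
      V.character (pPrimePart p g) = algebraMap 𝒪 K b ∧ a - b ∈ 𝔭 := by
  have : CharP (𝒪 ⧸ 𝔭) p := by
    have h0 : (p : 𝒪 ⧸ 𝔭) = 0 := by
      rw [← map_natCast (Ideal.Quotient.mk 𝔭)]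
      exact Ideal.Quotient.eq_zero_iff_mem.2 hp
    exact (CharP.charP_iff_prime_eq_zero Fact.out).2 h0
  obtain ⟨m, hm, hpow⟩ := exists_pPrimePart_eq_pow_and_pow_eq (k := 𝒪 ⧸ 𝔭) (p := p) g
  obtain ⟨d, hd⟩ := orderOf_dvd_natCard g
  have hξ : IsPrimitiveRoot (ζ ^ d) (orderOf g) := hζ.pow Nat.card_pos (hd.trans (mul_comm _ _))
  obtain ⟨r, hr⟩ := LinearMap.exists_trace_pow_eq_sum (orderOf_pos g) hξ (T := V.ρ g)
    (by rw [← map_pow, pow_orderOf_eq_one, map_one])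
  obtain ⟨w, hw⟩ : ∃ w : 𝒪, algebraMap 𝒪 K w = ζ ^ d :=
    IsIntegrallyClosed.isIntegral_iff.1 (hξ.isIntegral (orderOf_pos g)).tower_top
  have hwn : w ^ orderOf g = 1 := IsFractionRing.injective 𝒪 K <| by
    rw [map_pow, hw, hξ.pow_eq_one, map_one]
  have hchar (j : ℕ) : V.character (g ^ j) =
      algebraMap 𝒪 K (∑ i ∈ Finset.range (orderOf g), (r i : 𝒪) * (w ^ i) ^ j) := by
    rw [FDRep.character, map_pow, hr]
    simp [hw]
  refine ⟨_, _, (congr_arg V.character (pow_one g).symm).trans (hchar 1), hm ▸ hchar m, ?_⟩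
  rw [← Ideal.Quotient.eq]
  simp only [map_sum, map_mul, map_pow, map_natCast, pow_one]
  refine Finset.sum_congr rfl fun i _ => ?_
  rw [hpow _ ?_]
  rw [pow_right_comm, ← map_pow, hwn, map_one, one_pow]

/-- The value of a virtual character at `g` is integral, and congruent modulo `𝔭` to its value at
the `p'`-part of `g`. -/
theorem exists_charRing_apply_pPrimePart_sub_mem {𝒪 : Type*} {K G : Type u} [CommRing 𝒪]
    [IsIntegrallyClosed 𝒪] [Field K] [Algebra 𝒪 K] [IsFractionRing 𝒪 K]
    {𝔭 : Ideal 𝒪} [𝔭.IsPrime] {p : ℕ} [Fact p.Prime] (hp : (p : 𝒪) ∈ 𝔭) [Group G] [Finite G]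
    {ζ : K} (hζ : IsPrimitiveRoot ζ (Nat.card G)) (g : G) {f : G → K} (hf : f ∈ charRing K G) :
    ∃ a b : 𝒪, f g = algebraMap 𝒪 K a ∧ f (pPrimePart p g) = algebraMap 𝒪 K b ∧ a - b ∈ 𝔭 := by
  induction hf using Subring.closure_induction with
  | mem f hf =>
    obtain ⟨V, rfl⟩ := hf
    exact exists_character_pPrimePart_sub_mem hp hζ g V
  | zero => exact ⟨0, 0, by simp⟩
  | one => exact ⟨1, 1, by simp⟩
  | add f₁ f₂ _ _ h₁ h₂ =>
    obtain ⟨a₁, b₁, ha₁, hb₁, h₁⟩ := h₁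
    obtain ⟨a₂, b₂, ha₂, hb₂, h₂⟩ := h₂
    refine ⟨a₁ + a₂, b₁ + b₂, by simp [ha₁, ha₂], by simp [hb₁, hb₂], ?_⟩
    rw [add_sub_add_comm]
    exact Ideal.add_mem _ h₁ h₂
  | neg f _ h =>
    obtain ⟨a, b, ha, hb, h⟩ := h
    refine ⟨-a, -b, by simp [ha], by simp [hb], ?_⟩
    rw [← neg_sub', neg_mem_iff]
    exact h
  | mul f₁ f₂ _ _ h₁ h₂ =>
    obtain ⟨a₁, b₁, ha₁, hb₁, h₁⟩ := h₁
    obtain ⟨a₂, b₂, ha₂, hb₂, h₂⟩ := h₂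
    exact ⟨a₁ * a₂, b₁ * b₂, by simp [ha₁, ha₂], by simp [hb₁, hb₂], Ideal.mul_sub_mul_mem _ h₁ h₂⟩

variable {𝒪 : Type*} [CommRing 𝒪] [IsDomain 𝒪] [IsDedekindDomain 𝒪] [CharZero 𝒪]
variable {K : Type u} [Field K] [Algebra 𝒪 K] [IsFractionRing 𝒪 K]
variable {𝔭 : Ideal 𝒪} [𝔭.IsMaximal]

/-- For `g, h ∈ G`, the images of `χ(g)` and `χ(h)` in `k = 𝒪/𝔭` coincide
for every virtual character `χ ∈ R(G)` if and only if the `p'`-parts `g_{p'}` and `h_{p'}`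
are conjugate in `G`. -/
theorem values_congruent_iff_pPrimeParts_conjugate
    (p : ℕ) [Fact p.Prime] (hp : (p : 𝒪) ∈ 𝔭)
    {G : Type u} [Group G] [Finite G]
    (ζ : K) (hζ : IsPrimitiveRoot ζ (Nat.card G))
    (g h : G) :
    (∀ f ∈ charRing K G, ∀ a b : 𝒪,
        f g = algebraMap 𝒪 K a → f h = algebraMap 𝒪 K b →
        Ideal.Quotient.mk 𝔭 a = Ideal.Quotient.mk 𝔭 b) ↔
      IsConj (pPrimePart p g) (pPrimePart p h) := by
  have hK : CharZero K := charZero_of_injective_algebraMap (IsFractionRing.injective 𝒪 K)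
  have hinj := IsFractionRing.injective 𝒪 K
  constructor
  · intro H
    obtain ⟨d, hd⟩ := orderOf_dvd_natCard (pPrimePart p g)
    refine isConj_of_forall_character_sub_mem (Ideal.IsMaximal.ne_top ‹_›) hp
      (coprime_orderOf_pPrimePart p g) (coprime_orderOf_pPrimePart p h)
      (hζ.pow Nat.card_pos (hd.trans (mul_comm _ _))) fun V => ?_
    obtain ⟨a, a', ha, ha', haa⟩ := exists_character_pPrimePart_sub_mem hp hζ g V
    obtain ⟨b, b', hb, hb', hbb⟩ := exists_character_pPrimePart_sub_mem hp hζ h V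
    have hab := H _ (Subring.subset_closure ⟨V, rfl⟩) a b ha hb
    rw [← Ideal.Quotient.eq] at haa hbb
    refine ⟨a', b', ha', hb', ?_⟩
    rw [← Ideal.Quotient.eq, ← haa, ← hbb, hab]
  · intro H f hf a b ha hb
    obtain ⟨a₁, a', ha₁, ha', haa⟩ := exists_charRing_apply_pPrimePart_sub_mem hp hζ g hf
    obtain ⟨b₁, b', hb₁, hb', hbb⟩ := exists_charRing_apply_pPrimePart_sub_mem hp hζ h hf
    obtain rfl : a = a₁ := hinj (ha.symm.trans ha₁)
    obtain rfl : b = b₁ := hinj (hb.symm.trans hb₁)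
    obtain rfl : a' = b' := hinj (by rw [← ha', ← hb', charRing_apply_eq_of_isConj hf H])
    rw [← Ideal.Quotient.eq] at haa hbb
    rw [haa, hbb]
end
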